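/- Let X, Y be compacta and R ⊆ exp X × exp Y an ambiguous representation. Then the relation R^⊣ ⊆ exp Y × exp X, defined by (B̃,Ã) ∈ R^⊣ if and only if for every A ∈ exp X with A∩Ã = ∅ there exists B ∈ AR with B∩B̃ = ∅, is an ambiguous representation between Y and X. -/

import Mathlib

open Set Topology

/-- The hyperspace `exp X` of all nonempty closed subsets of `X`. -/
structure Exp (X : Type*) [TopologicalSpace X] where
  carrier : Set X
  isClosed' : IsClosed carrier
  nonempty' : carrier.Nonempty

namespace Exp

variable {X : Type*} [TopologicalSpace X]

/-- The Vietoris topology on `exp X`, generated by the subbase consisting of the sets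
`⟨U⟩ = {F | F ⊆ U}` and `⟨X, U⟩ = {F | F ∩ U ≠ ∅}` for open `U ⊆ X`. -/
instance topologicalSpace : TopologicalSpace (Exp X) :=
  TopologicalSpace.generateFrom
    ({S | ∃ U : Set X, IsOpen U ∧ S = {F : Exp X | F.carrier ⊆ U}} ∪
     {S | ∃ U : Set X, IsOpen U ∧ S = {F : Exp X | (F.carrier ∩ U).Nonempty}})

/-- The whole space `X` as an element of `exp X`. -/
def univ (X : Type*) [TopologicalSpace X] [Nonempty X] : Exp X :=
  ⟨Set.univ, isClosed_univ, Set.univ_nonempty⟩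

/-- Union of two elements of `exp X`. -/
def union (F G : Exp X) : Exp X :=
  ⟨F.carrier ∪ G.carrier, F.isClosed'.union G.isClosed',
    Set.union_nonempty.mpr (Or.inl F.nonempty')⟩

end Exp

section AmbiguousRepresentations

variable {X Y Z : Type*} [TopologicalSpace X] [TopologicalSpace Y] [TopologicalSpace Z]

/-- An ambiguous representation between `X` and `Y`:
(a) antitone in the first argument and isotone in the second;
(b) `(A, Y) ∈ R` for all `A`;
(c) all sets `AR = {B | (A,B) ∈ R}` are closed in the Vietoris topology. -/
def IsAmbRep [Nonempty Y] (R : Set (Exp X × Exp Y)) : Prop :=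
  (∀ (A A' : Exp X) (B B' : Exp Y),
      (A, B) ∈ R → A'.carrier ⊆ A.carrier → B.carrier ⊆ B'.carrier → (A', B') ∈ R) ∧
  (∀ A : Exp X, (A, Exp.univ Y) ∈ R) ∧
  (∀ A : Exp X, IsClosed {B : Exp Y | (A, B) ∈ R})

/-- The relation `R^⊣ ⊆ exp Y × exp X`: `(B̃, Ã) ∈ R^⊣` iff for every `A ∈ exp X` with
`A ∩ Ã = ∅` there exists `B ∈ AR` with `B ∩ B̃ = ∅`. -/
def sms (R : Set (Exp X × Exp Y)) : Set (Exp Y × Exp X) :=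
  {p | ∀ A : Exp X, A.carrier ∩ p.2.carrier = ∅ →
      ∃ B : Exp Y, (A, B) ∈ R ∧ B.carrier ∩ p.1.carrier = ∅}

/-- A strict ambiguous representation: additionally all sets `RB = {A | (A,B) ∈ R}`
are closed. -/
def IsStrictAmbRep [Nonempty Y] (R : Set (Exp X × Exp Y)) : Prop :=
  IsAmbRep R ∧ ∀ B : Exp Y, IsClosed {A : Exp X | (A, B) ∈ R}

/-- An open ambiguous representation: strict, pseudo-invertible, and `R^⊣` is strict. -/
def IsOpenAmbRep [Nonempty X] [Nonempty Y] (R : Set (Exp X × Exp Y)) : Prop :=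
  IsStrictAmbRep R ∧ sms (sms R) = R ∧ IsStrictAmbRep (sms R)

/-- The composition `R ⊚ S`: `A (R ⊚ S)` is the closure of
`{C | ∃ B, (A,B) ∈ R ∧ (B,C) ∈ S}`. -/
def bcomp (R : Set (Exp X × Exp Y)) (S : Set (Exp Y × Exp Z)) : Set (Exp X × Exp Z) :=
  {p | p.2 ∈ closure {C : Exp Z | ∃ B : Exp Y, (p.1, B) ∈ R ∧ (B, C) ∈ S}}

/-- The relational composition of `R` and `S`. -/
def rcomp (R : Set (Exp X × Exp Y)) (S : Set (Exp Y × Exp Z)) : Set (Exp X × Exp Z) :=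
  {p | ∃ B : Exp Y, (p.1, B) ∈ R ∧ (B, p.2) ∈ S}

end AmbiguousRepresentations

/-- The closed sets meeting a fixed closed set form a closed subset of the hyperspace. -/
theorem Exp.isClosed_setOf_inter_ne_empty {X : Type*} [TopologicalSpace X] (A : Exp X) :
    IsClosed {F : Exp X | A.carrier ∩ F.carrier ≠ ∅} := by
  rw [← isOpen_compl_iff]
  refine TopologicalSpace.isOpen_generateFrom_of_mem
    (Or.inl ⟨A.carrierᶜ, A.isClosed'.isOpen_compl, ?_⟩)
  ext F
  simp [← disjoint_iff_inter_eq_empty, subset_compl_iff_disjoint_left]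

/-- If `R` is an ambiguous representation between compacta `X` and `Y`, then `R^⊣` is an
ambiguous representation between `Y` and `X`. -/
theorem statement2 {X Y : Type*}
    [TopologicalSpace X] [CompactSpace X] [T2Space X] [Nonempty X]
    [TopologicalSpace Y] [CompactSpace Y] [T2Space Y] [Nonempty Y]
    (R : Set (Exp X × Exp Y)) (hR : IsAmbRep R) :
    IsAmbRep (sms R) := by
  refine ⟨fun B B' A A' h hB hA C hC => ?_, fun B A hA => ?_, fun B => ?_⟩
  · obtain ⟨D, hD, hDB⟩ := h C (subset_eq_empty (inter_subset_inter_right _ hA) hC)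
    exact ⟨D, hD, subset_eq_empty (inter_subset_inter_right _ hB) hDB⟩
  · exact absurd ((inter_univ A.carrier).symm.trans hA) A.nonempty'.ne_empty
  · have h : {A' : Exp X | (B, A') ∈ sms R} =
        ⋂ A ∈ {A : Exp X | ¬ ∃ D : Exp Y, (A, D) ∈ R ∧ D.carrier ∩ B.carrier = ∅},
          {A' : Exp X | A.carrier ∩ A'.carrier ≠ ∅} := by
      ext A'
      simp only [mem_iInter, mem_ofPred_eq]
      exact forall_congr' fun A => not_imp_not.symm
    rw [h]
    exact isClosed_biInter fun A _ => A.isClosed_setOf_inter_ne_empty
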